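/- For y ∈ ℝ let s(y) = y − ⌊y + 1/2⌋ (the periodized sawtooth, taking values in [−1/2, 1/2)), and let G(t) = lim_{R→∞} ∫_{−R}^{R} s(t + η²/2) dη (which exists for every t). Then G is periodic with period 1: G(t + 1) = G(t) for all t ∈ ℝ. Moreover G is not identically zero. -/

import Mathlib

open Filter

/-- The periodized sawtooth `s(y) = y − ⌊y + 1/2⌋`, taking values in `[−1/2, 1/2)`. -/
noncomputable def saw (y : ℝ) : ℝ := y - ⌊y + 1 / 2⌋

theorem saw_add_one (y : ℝ) : saw (y + 1) = saw y := by
  have h : y + 1 + 1 / 2 = y + 1 / 2 + 1 := by ring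
  rw [saw, saw, h, Int.floor_add_one]
  push_cast
  ring

theorem abs_saw_le (y : ℝ) : |saw y| ≤ 1 / 2 := by
  have h₁ := Int.floor_le (y + 1 / 2)
  have h₂ := Int.lt_floor_add_one (y + 1 / 2)
  rw [saw, abs_le]
  constructor <;> linarith

theorem measurable_saw : Measurable saw :=
  measurable_id.sub ((measurable_from_top (f := fun n : ℤ => (n : ℝ))).comp
    (Int.measurable_floor.comp (measurable_id.add_const _)))

theorem intervalIntegrable_saw_sq (t a b : ℝ) :
    IntervalIntegrable (fun η : ℝ => saw (t + η ^ 2 / 2)) MeasureTheory.volume a b := by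
  refine (intervalIntegrable_const (c := (1 / 2 : ℝ))).mono_fun
    (measurable_saw.comp (by fun_prop)).aestronglyMeasurable
    (MeasureTheory.ae_of_all _ fun η => ?_)
  exact (abs_saw_le _).trans (le_abs_self _)

/-- The integral of `s(η²/2 - 1/2)` over one period of `η²/2`. -/
theorem integral_saw_sq_period (n : ℕ) {a b : ℝ} (ha : 0 ≤ a) (hab : a ≤ b)
    (ha2 : a ^ 2 = 2 * n) (hb2 : b ^ 2 = 2 * (n + 1)) :
    ∫ η in a..b, saw (-1 / 2 + η ^ 2 / 2) = -(b - a) ^ 3 / 12 := by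
  have hpoly : ∫ η in a..b, saw (-1 / 2 + η ^ 2 / 2) =
      ∫ η in a..b, (η ^ 2 / 2 - (n + 1 / 2 : ℝ)) := by
    refine intervalIntegral.integral_congr_Ioo_of_le hab fun η hη => ?_
    have hfloor : ⌊-1 / 2 + η ^ 2 / 2 + 1 / 2⌋ = (n : ℤ) := by
      rw [Int.floor_eq_iff]
      push_cast
      constructor <;> nlinarith [hη.1, hη.2]
    simp only [saw, hfloor]
    push_cast
    ring
  rw [hpoly, intervalIntegral.integral_sub
    (Continuous.intervalIntegrable (by fun_prop) _ _) intervalIntegrable_const,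
    intervalIntegral.integral_div, integral_pow, intervalIntegral.integral_const]
  have hn : (n : ℝ) = (a ^ 2 + b ^ 2) / 4 - 1 / 2 := by linarith
  rw [hn, smul_eq_mul]
  push_cast
  ring

theorem integral_saw_sq_symm (t R : ℝ) :
    ∫ η in (-R)..R, saw (t + η ^ 2 / 2) = 2 * ∫ η in (0)..R, saw (t + η ^ 2 / 2) := by
  have hneg : ∫ η in (-R)..0, saw (t + η ^ 2 / 2) = ∫ η in (0)..R, saw (t + η ^ 2 / 2) := by
    have h := intervalIntegral.integral_comp_neg (a := 0) (b := R)
      (fun η : ℝ => saw (t + η ^ 2 / 2))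
    simpa using h.symm
  rw [← intervalIntegral.integral_add_adjacent_intervals
    (intervalIntegrable_saw_sq t (-R) 0) (intervalIntegrable_saw_sq t 0 R), hneg]
  ring

theorem integral_saw_sq_sqrt_le (n : ℕ) :
    ∫ η in (0)..√(2 * (n + 1)), saw (-1 / 2 + η ^ 2 / 2) ≤ -√2 ^ 3 / 12 := by
  induction n with
  | zero =>
    have h := integral_saw_sq_period 0 (a := 0) (b := √2) le_rfl (Real.sqrt_nonneg _)
      (by simp) (by simp)
    simpa using h.le
  | succ n ih =>
    have hle : √(2 * ((n : ℝ) + 1)) ≤ √(2 * (((n + 1 : ℕ) : ℝ) + 1)) :=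
      Real.sqrt_le_sqrt (by push_cast; linarith)
    have h := integral_saw_sq_period (n + 1) (Real.sqrt_nonneg _) hle
      (by rw [Real.sq_sqrt (by positivity)]; push_cast; ring)
      (by rw [Real.sq_sqrt (by positivity)])
    rw [← intervalIntegral.integral_add_adjacent_intervals
      (intervalIntegrable_saw_sq _ 0 _) (intervalIntegrable_saw_sq _ _ _), h]
    have hpos := pow_nonneg (sub_nonneg.2 hle) 3
    linarith

/-- the function `G(t) = lim_{R→∞} ∫_{−R}^{R} s(t + η²/2) dη`
is periodic with period 1 and is not identically zero. -/
theorem stmt_17 (G : ℝ → ℝ)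
    (hG : ∀ t : ℝ,
      Tendsto (fun R : ℝ => ∫ η in (-R)..R, saw (t + η ^ 2 / 2)) atTop (nhds (G t))) :
    (∀ t : ℝ, G (t + 1) = G t) ∧ (∃ t : ℝ, G t ≠ 0) := by
  refine ⟨fun t => tendsto_nhds_unique (hG (t + 1)) ?_, -1 / 2, ne_of_lt ?_⟩
  · have h : ∀ η : ℝ, saw (t + 1 + η ^ 2 / 2) = saw (t + η ^ 2 / 2) := fun η => by
      rw [← saw_add_one (t + η ^ 2 / 2)]
      ring_nf
    simpa only [h] using hG t
  · have hR : Tendsto (fun n : ℕ => √(2 * ((n : ℝ) + 1))) atTop atTop :=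
      Real.tendsto_sqrt_atTop.comp ((tendsto_atTop_add_const_right _ _
        tendsto_natCast_atTop_atTop).const_mul_atTop two_pos)
    have hle : G (-1 / 2) ≤ 2 * (-√2 ^ 3 / 12) :=
      le_of_tendsto' ((hG (-1 / 2)).comp hR) fun n => by
        rw [Function.comp_apply, integral_saw_sq_symm]
        exact mul_le_mul_of_nonneg_left (integral_saw_sq_sqrt_le n) two_pos.le
    have hpos : (0 : ℝ) < √2 ^ 3 := by positivity
    linarith
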